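/- Let q1, q2, q3 ∈ ℕ, q = min(q1, q2, q3), with distinct nodes {η1^{(i)}} ⊂ [−1,1], {η2^{(i)}} ⊂ [−1,1), {η3^{(i)}} ⊂ [−1,1) and Lagrange bases ℓ1^{(i)}, ℓ2^{(i)}, ℓ3^{(i)}, and set ξ^{(α)} = χ(η1^{(α1)}, η2^{(α2)}, η3^{(α3)}). Define the collapsed-coordinate differentiation matrices D^{(1)}, D^{(2)}, D^{(3)} with entries D^{(1)}_{α,β} = (4/((1−η2^{(α2)})(1−η3^{(α3)}))) (ℓ1^{(β1)})'(η1^{(α1)}) δ_{α2β2} δ_{α3β3}; D^{(2)}_{α,β} = (2(1+η1^{(α1)})/((1−η2^{(α2)})(1−η3^{(α3)}))) (ℓ1^{(β1)})'(η1^{(α1)}) δ_{α2β2} δ_{α3β3} + (2/(1−η3^{(α3)})) δ_{α1β1} (ℓ2^{(β2)})'(η2^{(α2)}) δ_{α3β3}; D^{(3)}_{α,β} = (2(1+η1^{(α1)})/((1−η2^{(α2)})(1−η3^{(α3)}))) (ℓ1^{(β1)})'(η1^{(α1)}) δ_{α2β2} δ_{α3β3} + ((1+η2^{(α2)})/(1−η3^{(α3)}))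 δ_{α1β1} (ℓ2^{(β2)})'(η2^{(α2)}) δ_{α3β3} + δ_{α1β1} δ_{α2β2} (ℓ3^{(β3)})'(η3^{(α3)}). Then for every trivariate polynomial v of total degree at most q, every m ∈ {1,2,3}, and every multi-index α, ∑_{β} D^{(m)}_{α,β} v(ξ^{(β)}) = (∂v/∂ξ_m)(ξ^{(α)}). -/

import Mathlib

noncomputable section

/-- The collapsed coordinate map from the cube onto the reference tetrahedron. -/
def chi3 (η : ℝ × ℝ × ℝ) : ℝ × ℝ × ℝ :=
  ((1 + η.1) * (1 - η.2.1) * (1 - η.2.2) / 4 - 1,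
   (1 + η.2.1) * (1 - η.2.2) / 2 - 1, η.2.2)

/-- Lagrange basis function on the nodes `η`. -/
def lagr {n : ℕ} (η : Fin n → ℝ) (i : Fin n) (x : ℝ) : ℝ :=
  ∏ j ∈ Finset.univ.erase i, (x - η j) / (η i - η j)

/-- Evaluation of a trivariate polynomial at a point of `ℝ × ℝ × ℝ`. -/
def ev3 (v : MvPolynomial (Fin 3) ℝ) (x : ℝ × ℝ × ℝ) : ℝ :=
  MvPolynomial.eval ![x.1, x.2.1, x.2.2] v

/-- The reference tetrahedron `T̂ = {ξ ∈ [−1,1]³ : ξ1 + ξ2 + ξ3 ≤ −1}`. -/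
def refTet : Set (ℝ × ℝ × ℝ) :=
  {ξ | ξ.1 ∈ Set.Icc (-1:ℝ) 1 ∧ ξ.2.1 ∈ Set.Icc (-1:ℝ) 1 ∧ ξ.2.2 ∈ Set.Icc (-1:ℝ) 1 ∧
    ξ.1 + ξ.2.1 + ξ.2.2 ≤ -1}

/-- A one-dimensional quadrature rule with nodes `η` and weights `ω` is exact of degree `τ`. -/
def exact1D {n : ℕ} (η ω : Fin n → ℝ) (τ : ℕ) : Prop :=
  ∀ f : Polynomial ℝ, f.natDegree ≤ τ →
    ∑ i, ω i * f.eval (η i) = ∫ x in (-1:ℝ)..1, f.eval x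

open Polynomial in
theorem lagr_eq_eval_basis {n : ℕ} (η : Fin n → ℝ) (i : Fin n) :
    lagr η i = fun x => (Lagrange.basis Finset.univ η i).eval x := by
  funext x
  simp only [lagr, Lagrange.basis, Lagrange.basisDivisor, eval_prod]
  refine Finset.prod_congr rfl fun j _ => ?_
  simp [div_eq_inv_mul]

open Polynomial in
/-- Lagrange interpolation on `n` nodes differentiates polynomials of degree less than `n`
exactly. -/
theorem sum_deriv_lagr_mul_eval {n : ℕ} {η : Fin n → ℝ} (hη : Function.Injective η)
    {p : ℝ[X]} (hp : p.degree < n) (x : ℝ) :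
    ∑ b, deriv (lagr η b) x * p.eval (η b) = p.derivative.eval x := by
  conv_rhs =>
    rw [Lagrange.eq_interpolate (f := p) (s := Finset.univ) (v := η) hη.injOn (by simpa using hp)]
  simp [Lagrange.interpolate_apply, lagr_eq_eval_basis, eval_finsetSum, mul_comm]

open Polynomial in
/-- The chain rule for a multivariate polynomial evaluated along a polynomial curve. -/
theorem derivative_aeval_mvPolynomial {σ R : Type*} [Fintype σ] [CommRing R]
    (p : σ → R[X]) (v : MvPolynomial σ R) :
    derivative (MvPolynomial.aeval p v) =
      ∑ i, MvPolynomial.aeval p (MvPolynomial.pderiv i v) * derivative (p i) := by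
  classical
  induction v using MvPolynomial.induction_on with
  | C a => simp
  | add f g hf hg => simp [hf, hg, add_mul, Finset.sum_add_distrib]
  | mul_X f i hf =>
    simp only [map_mul, MvPolynomial.aeval_X, derivative_mul, hf, Derivation.leibniz,
      MvPolynomial.pderiv_X, smul_eq_mul, map_add, add_mul, Finset.sum_add_distrib]
    rw [add_comm]
    congr 1
    · rw [Finset.sum_eq_single i]
      · simp
      · intro j _ hj
        simp [hj.symm]
      · simp
    · rw [Finset.sum_mul]
      exact Finset.sum_congr rfl fun j _ => by ring

theorem eval_aeval_eq_ev3 (p : Fin 3 → Polynomial ℝ) (v : MvPolynomial (Fin 3) ℝ) (t : ℝ) :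
    (MvPolynomial.aeval p v).eval t =
      ev3 v ((p 0).eval t, (p 1).eval t, (p 2).eval t) := by
  have h : ![(p 0).eval t, (p 1).eval t, (p 2).eval t] = fun i => (p i).eval t := by
    funext i
    fin_cases i <;> rfl
  rw [ev3, h, ← Polynomial.coe_evalRingHom, MvPolynomial.map_aeval]
  have hC : (Polynomial.evalRingHom t).comp (algebraMap ℝ (Polynomial ℝ)) = RingHom.id ℝ := by
    ext
    simp
  rw [hC]
  rfl

open Polynomial in
/-- Along an affine line, Lagrange differentiation yields the directional derivative. -/
theorem sum_deriv_lagr_mul_ev3 {n : ℕ} {η : Fin (n + 1) → ℝ} (hη : Function.Injective η)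
    {v : MvPolynomial (Fin 3) ℝ} (hv : v.totalDegree ≤ n) {g : ℝ → ℝ × ℝ × ℝ}
    (c d : Fin 3 → ℝ) (hg : ∀ t, g t = (d 0 * t + c 0, d 1 * t + c 1, d 2 * t + c 2)) (x : ℝ) :
    ∑ b, deriv (lagr η b) x * ev3 v (g (η b)) =
      d 0 * ev3 (MvPolynomial.pderiv 0 v) (g x) + d 1 * ev3 (MvPolynomial.pderiv 1 v) (g x) +
        d 2 * ev3 (MvPolynomial.pderiv 2 v) (g x) := by
  have hdeg : (MvPolynomial.aeval (fun i => C (d i) * X + C (c i)) v).degree <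
      ((n + 1 : ℕ) : WithBot ℕ) := by
    refine degree_le_natDegree.trans_lt ?_
    have := MvPolynomial.aeval_natDegree_le v hv (fun i => C (d i) * X + C (c i))
      (fun i => natDegree_linear_le)
    exact_mod_cast (show _ < n + 1 by omega)
  have h := sum_deriv_lagr_mul_eval hη hdeg x
  rw [derivative_aeval_mvPolynomial, eval_finsetSum] at h
  simp only [eval_aeval_eq_ev3, eval_mul, eval_add, eval_C, eval_X, ← hg, derivative_add,
    derivative_C_mul, derivative_X, derivative_C, Fin.sum_univ_three, mul_one, add_zero] at h
  rw [h]
  ring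

theorem differentiation_matrices_exact_tetrahedron (q1 q2 q3 : ℕ)
    (η1 : Fin (q1 + 1) → ℝ) (η2 : Fin (q2 + 1) → ℝ) (η3 : Fin (q3 + 1) → ℝ)
    (hinj1 : Function.Injective η1) (hinj2 : Function.Injective η2)
    (hinj3 : Function.Injective η3)
    (hr1 : ∀ i, η1 i ∈ Set.Icc (-1:ℝ) 1) (hr2 : ∀ i, η2 i ∈ Set.Ico (-1:ℝ) 1)
    (hr3 : ∀ i, η3 i ∈ Set.Ico (-1:ℝ) 1)
    (v : MvPolynomial (Fin 3) ℝ) (hv : v.totalDegree ≤ min q1 (min q2 q3))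
    (a1 : Fin (q1 + 1)) (a2 : Fin (q2 + 1)) (a3 : Fin (q3 + 1)) :
    (∑ b1 : Fin (q1 + 1), ∑ b2 : Fin (q2 + 1), ∑ b3 : Fin (q3 + 1),
        ((4 / ((1 - η2 a2) * (1 - η3 a3))) * deriv (lagr η1 b1) (η1 a1) *
          (if a2 = b2 then (1:ℝ) else 0) * (if a3 = b3 then (1:ℝ) else 0)) *
          ev3 v (chi3 (η1 b1, η2 b2, η3 b3))
        = ev3 (MvPolynomial.pderiv 0 v) (chi3 (η1 a1, η2 a2, η3 a3))) ∧
    (∑ b1 : Fin (q1 + 1), ∑ b2 : Fin (q2 + 1), ∑ b3 : Fin (q3 + 1),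
        ((2 * (1 + η1 a1) / ((1 - η2 a2) * (1 - η3 a3))) * deriv (lagr η1 b1) (η1 a1) *
            (if a2 = b2 then (1:ℝ) else 0) * (if a3 = b3 then (1:ℝ) else 0)
          + (2 / (1 - η3 a3)) * (if a1 = b1 then (1:ℝ) else 0) *
            deriv (lagr η2 b2) (η2 a2) * (if a3 = b3 then (1:ℝ) else 0)) *
          ev3 v (chi3 (η1 b1, η2 b2, η3 b3))
        = ev3 (MvPolynomial.pderiv 1 v) (chi3 (η1 a1, η2 a2, η3 a3))) ∧
    (∑ b1 : Fin (q1 + 1), ∑ b2 : Fin (q2 + 1), ∑ b3 : Fin (q3 + 1),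
        ((2 * (1 + η1 a1) / ((1 - η2 a2) * (1 - η3 a3))) * deriv (lagr η1 b1) (η1 a1) *
            (if a2 = b2 then (1:ℝ) else 0) * (if a3 = b3 then (1:ℝ) else 0)
          + ((1 + η2 a2) / (1 - η3 a3)) * (if a1 = b1 then (1:ℝ) else 0) *
            deriv (lagr η2 b2) (η2 a2) * (if a3 = b3 then (1:ℝ) else 0)
          + (if a1 = b1 then (1:ℝ) else 0) * (if a2 = b2 then (1:ℝ) else 0) *
            deriv (lagr η3 b3) (η3 a3)) *
          ev3 v (chi3 (η1 b1, η2 b2, η3 b3))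
        = ev3 (MvPolynomial.pderiv 2 v) (chi3 (η1 a1, η2 a2, η3 a3))) := by
  have h2 : 1 - η2 a2 ≠ 0 := sub_ne_zero.mpr (hr2 a2).2.ne'
  have h3 : 1 - η3 a3 ≠ 0 := sub_ne_zero.mpr (hr3 a3).2.ne'
  simp only [le_min_iff] at hv
  obtain ⟨hv1, hv2, hv3⟩ := hv
  have d1 := sum_deriv_lagr_mul_ev3 hinj1 hv1 (g := fun t => chi3 (t, η2 a2, η3 a3))
    ![(1 - η2 a2) * (1 - η3 a3) / 4 - 1, (1 + η2 a2) * (1 - η3 a3) / 2 - 1, η3 a3]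
    ![(1 - η2 a2) * (1 - η3 a3) / 4, 0, 0]
    (fun t => by ext <;> simp [chi3]; ring) (η1 a1)
  have d2 := sum_deriv_lagr_mul_ev3 hinj2 hv2 (g := fun t => chi3 (η1 a1, t, η3 a3))
    ![(1 + η1 a1) * (1 - η3 a3) / 4 - 1, (1 - η3 a3) / 2 - 1, η3 a3]
    ![-((1 + η1 a1) * (1 - η3 a3) / 4), (1 - η3 a3) / 2, 0]
    (fun t => by ext <;> simp [chi3] <;> ring) (η2 a2)
  have d3 := sum_deriv_lagr_mul_ev3 hinj3 hv3 (g := fun t => chi3 (η1 a1, η2 a2, t))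
    ![(1 + η1 a1) * (1 - η2 a2) / 4 - 1, (1 + η2 a2) / 2 - 1, 0]
    ![-((1 + η1 a1) * (1 - η2 a2) / 4), -((1 + η2 a2) / 2), 1]
    (fun t => by ext <;> simp [chi3] <;> ring) (η3 a3)
  simp only [Matrix.cons_val] at d1 d2 d3
  refine ⟨?_, ?_, ?_⟩ <;>
  · simp only [add_mul, Finset.sum_add_distrib, mul_ite, ite_mul, mul_one, mul_zero, zero_mul,
      one_mul, Finset.sum_ite_eq, Finset.mem_univ, if_true, Finset.sum_ite_irrel,
      Finset.sum_const_zero, mul_assoc, ← Finset.mul_sum, d1, d2, d3]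
    field_simp
    ring
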